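/- (Proposition 3.1, part 1) Let α ∈ ℝ and W''(m) ∈ ℝ be fixed. If W''(m) + min_{k ∈ 2πℤ^N, k ≠ 0} (α − |k|²)² ≥ 0, then P_N ≥ W''(m) + min_{k ∈ 2πℤ^N, k ≠ 0} (α − |k|²)². -/

import Mathlib

open MeasureTheory Filter Real

noncomputable section

abbrev Pt (N : ℕ) := Fin N → ℝ

/-- partial derivative in direction `i` -/
def pd {N : ℕ} (i : Fin N) (f : Pt N → ℝ) (x : Pt N) : ℝ := fderiv ℝ f x (Pi.single i 1)

/-- second partial derivative ∂ᵢ∂ⱼ -/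
def pd2 {N : ℕ} (i j : Fin N) (f : Pt N → ℝ) : Pt N → ℝ := pd i (pd j f)

/-- the unit cube [0,1]^N, fundamental domain of the torus 𝕋^N -/
def cube (N : ℕ) : Set (Pt N) := Set.Icc 0 1

/-- Laplacian on the torus -/
def lap {N : ℕ} (f : Pt N → ℝ) (x : Pt N) : ℝ := ∑ i, pd2 i i f x

/-- |∇f|² -/
def gradSq {N : ℕ} (f : Pt N → ℝ) (x : Pt N) : ℝ := ∑ i, (pd i f x)^2

/-- 1-periodicity in each coordinate: a function on the torus 𝕋^N -/
def ZPeriodic {N : ℕ} (f : Pt N → ℝ) : Prop :=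
  ∀ (x : Pt N) (i : Fin N), f (x + Pi.single i 1) = f x

/-- min_{k ∈ 2πℤ^N, k ≠ 0} (α - |k|²)² -/
def freqMinPFC (N : ℕ) (α : ℝ) : ℝ :=
  sInf {t : ℝ | ∃ k : Fin N → ℤ, k ≠ 0 ∧ t = (α - 4*π^2 * ∑ i, ((k i : ℝ))^2)^2}

/-- admissible test functions in the definition of P_N -/
def AdmissibleP {N : ℕ} (u : Pt N → ℝ) : Prop :=
  ContDiff ℝ 2 u ∧ ZPeriodic u ∧
    (∫ x in cube N, (u x)^3) = 1 ∧ (∫ x in cube N, u x) = 0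

/-- the product (∫ (αu+Δu)² + c u²) · (∫ u⁴) -/
def Penergy {N : ℕ} (α c : ℝ) (u : Pt N → ℝ) : ℝ :=
  (∫ x in cube N, ((α * u x + lap u x)^2 + c * (u x)^2)) * (∫ x in cube N, (u x)^4)

/-- the optimal constant P_N (with c = W''(m)) -/
def PN (N : ℕ) (α c : ℝ) : ℝ :=
  sInf {p : ℝ | ∃ u : Pt N → ℝ, AdmissibleP u ∧ p = Penergy α c u}

/-- membership in H²_m(𝕋^N) -/
def MemH2m {N : ℕ} (m : ℝ) (φ : Pt N → ℝ) : Prop :=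
  ContDiff ℝ 2 φ ∧ ZPeriodic φ ∧ (∫ x in cube N, φ x) = m

/-- the PFC functional 𝓕 on the torus -/
def Fen {N : ℕ} (α : ℝ) (W : ℝ → ℝ) (φ : Pt N → ℝ) : ℝ :=
  ∫ x in cube N, ((1/2) * (α * φ x + lap φ x)^2 + W (φ x))


lemma zper_add {N : ℕ} {f : Pt N → ℝ} (hf : ZPeriodic f) (n : Fin N → ℤ) (x : Pt N) :
    f (x + fun i => (n i : ℝ)) = f x := by
  have key : ∀ s : Finset (Fin N), ∀ x, f (x + ∑ i ∈ s, (n i) • (Pi.single i (1:ℝ) : Pt N)) = f x := by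
    intro s
    induction s using Finset.induction_on with
    | empty => intro x; simp
    | insert a s ha ih =>
      intro x
      rw [Finset.sum_insert ha, ← add_assoc, ih]
      have hp : Function.Periodic f (Pi.single a (1:ℝ) : Pt N) := fun x => hf x a
      exact hp.zsmul (n a) x
  have h := key Finset.univ x
  have e : (∑ i, (n i) • (Pi.single i (1:ℝ) : Pt N)) = fun i => (n i : ℝ) := by
    ext j
    simp [Finset.sum_apply, Pi.single_apply]
  rwa [e] at h

lemma exists_lift {N : ℕ} {f : Pt N → ℝ} (hf : ZPeriodic f) (hc : Continuous f) :
    ∃ F : C(UnitAddTorus (Fin N), ℂ), ∀ x : Pt N, F (fun i => (x i : UnitAddCircle)) = (f x : ℂ) := by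
  have hq : IsOpenQuotientMap (fun (x : Pt N) => (fun i => (x i : UnitAddCircle) : UnitAddTorus (Fin N))) :=
    IsOpenQuotientMap.piMap (fun _ => QuotientAddGroup.isOpenQuotientMap_mk)
  let p : C(Pt N, UnitAddTorus (Fin N)) := ⟨_, hq.continuous⟩
  let g : C(Pt N, ℂ) := ⟨fun x => (f x : ℂ), by fun_prop⟩
  have hpq : Topology.IsQuotientMap p := hq.isQuotientMap
  have hfac : Function.FactorsThrough g p := by
    intro x y hxy
    have : ∀ i, ∃ n : ℤ, y i = x i + n := by
      intro i
      have h := congrFun hxy i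
      have h2 : ((x i : UnitAddCircle)) = (y i : UnitAddCircle) := h
      rw [eq_comm, ← sub_eq_zero, ← AddCircle.coe_sub, AddCircle.coe_eq_zero_iff] at h2
      obtain ⟨m, hm⟩ := h2
      refine ⟨m, ?_⟩
      simp only [zsmul_eq_mul, mul_one] at hm
      linarith
    choose n hn using this
    have : y = x + fun i => (n i : ℝ) := by ext i; simp [hn]
    simp [g, this, zper_add hf]
  exact ⟨hpq.lift g hfac, fun x => DFunLike.congr_fun (hpq.lift_comp g hfac) x⟩

lemma cube_ae (N : ℕ) : ({x : Pt N | ∀ i, x i ∈ Set.Ioc ((0 : Pt N) i) ((0 : Pt N) i + 1)} : Set (Pt N)) =ᵐ[volume] cube N := by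
  have h := Measure.univ_pi_Ioc_ae_eq_Icc (μ := fun _ : Fin N => (volume : Measure ℝ)) (f := 0) (g := 1)
  have e : {x : Pt N | ∀ i, x i ∈ Set.Ioc ((0 : Pt N) i) ((0 : Pt N) i + 1)} =
      Set.univ.pi fun i => Set.Ioc ((0 : Pt N) i) ((1 : Pt N) i) := by
    ext x; simp
  rw [e]
  exact h

section pars
open UnitAddTorus

local instance instMS : MeasureSpace UnitAddCircle := ⟨AddCircle.haarAddCircle⟩

local instance instHaar : Measure.IsAddHaarMeasure (volume : Measure UnitAddCircle) :=
  inferInstanceAs (Measure.IsAddHaarMeasure AddCircle.haarAddCircle)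

local instance instProb : IsProbabilityMeasure (volume : Measure UnitAddCircle) :=
  inferInstanceAs (IsProbabilityMeasure AddCircle.haarAddCircle)

lemma parseval {N : ℕ} (F : C(UnitAddTorus (Fin N), ℂ)) :
    HasSum (fun k : Fin N → ℤ => ‖∫ x in cube N, mFourier (-k) (fun i => (x i : UnitAddCircle)) * F (fun i => (x i : UnitAddCircle))‖^2)
      (∫ x in cube N, ‖F (fun i => (x i : UnitAddCircle))‖^2) := by
  have h : HasSum (fun i ↦ ‖mFourierCoeff (F.toLp 2 volume ℂ) i‖ ^ 2)
      (∫ t, ‖(F.toLp 2 volume ℂ : Lp ℂ 2 (volume : Measure (UnitAddTorus (Fin N)))) t‖ ^ 2) :=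
    hasSum_sq_mFourierCoeff (F.toLp 2 volume ℂ)
  have h1 : ∀ k, mFourierCoeff (F.toLp 2 volume ℂ) k = mFourierCoeff F k := fun k => mFourierCoeff_toLp F k
  have h2 : ∀ G : Pt N → ℂ, ∫ x in {x : Pt N | ∀ i, x i ∈ Set.Ioc ((0 : Pt N) i) ((0 : Pt N) i + 1)}, G x = ∫ x in cube N, G x :=
    fun G => setIntegral_congr_set (cube_ae N)
  simp only [h1, mFourierCoeff_eq_integral _ _ 0, h2, smul_eq_mul] at h
  have h3 : (∫ t, ‖(F.toLp 2 volume ℂ : Lp ℂ 2 (volume : Measure (UnitAddTorus (Fin N)))) t‖ ^ 2)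
      = ∫ t : UnitAddTorus (Fin N), ‖F t‖^2 := by
    refine integral_congr_ae ?_
    filter_upwards [F.coeFn_toLp (p := 2) (𝕜 := ℂ) volume] with t ht
    rw [ht]
  have h4 : (∫ t : UnitAddTorus (Fin N), ‖F t‖^2) = ∫ x in cube N, ‖F (fun i => (x i : UnitAddCircle))‖^2 := by
    refine (integral_preimage (fun t => ‖F t‖^2) 0).trans ?_
    exact setIntegral_congr_set (cube_ae N)
  rw [h3, h4] at h
  exact h

end pars

def Ek {N : ℕ} (k : Fin N → ℤ) (x : Pt N) : ℂ :=
  Complex.exp (-(2 * π * Complex.I) * ∑ j, (k j : ℂ) * (x j : ℂ))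

lemma mFourier_eq {N : ℕ} (k : Fin N → ℤ) (x : Pt N) :
    UnitAddTorus.mFourier (-k) (fun i => (x i : UnitAddCircle)) = Ek k x := by
  simp only [UnitAddTorus.mFourier, ContinuousMap.coe_mk, fourier_coe_apply, Ek, ← Complex.exp_sum,
    Finset.mul_sum]
  congr 1
  refine Finset.sum_congr rfl fun i _ => ?_
  push_cast [Pi.neg_apply]
  ring

lemma Ek_contDiff {N : ℕ} (k : Fin N → ℤ) : ContDiff ℝ 1 (Ek k) := by
  have : ∀ j : Fin N, ContDiff ℝ 1 (fun x : Pt N => (x j : ℂ)) := fun j =>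
    Complex.ofRealCLM.contDiff.comp (contDiff_apply ℝ ℝ j)
  unfold Ek
  fun_prop

lemma Ek_fderiv {N : ℕ} (k : Fin N → ℤ) (x : Pt N) (i : Fin N) :
    fderiv ℝ (Ek k) x (Pi.single i 1) = -(2 * π * Complex.I) * k i * Ek k x := by
  have h0 : ∀ j : Fin N, HasFDerivAt (fun x : Pt N => (x j : ℂ))
      (Complex.ofRealCLM.comp (ContinuousLinearMap.proj (R := ℝ) (φ := fun _ : Fin N => ℝ) j)) x := fun j =>
    Complex.ofRealCLM.hasFDerivAt.comp x (hasFDerivAt_apply j x)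
  have h1 := (((HasFDerivAt.fun_sum (u := Finset.univ) (fun j _ => (h0 j).const_mul (k j : ℂ))).const_mul
    (-(2 * π * Complex.I))).cexp)
  have h2 : HasFDerivAt (Ek k) _ x := h1
  rw [h2.fderiv]
  have hs : ∑ j, (k j : ℂ) * ((if j = i then (1:ℝ) else 0 : ℝ) : ℂ) = k i := by
    rw [Finset.sum_eq_single i] <;> simp +contextual
  simp [Pi.single_apply, Ek, hs]
  ring

lemma pd_contDiff {N : ℕ} {u : Pt N → ℝ} (hu : ContDiff ℝ 2 u) (i : Fin N) : ContDiff ℝ 1 (pd i u) := by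
  have : ContDiff ℝ 1 (fderiv ℝ u) := hu.fderiv_right (by norm_num)
  exact this.clm_apply contDiff_const

lemma fderiv_zper {N : ℕ} {u : Pt N → ℝ} (hp : ZPeriodic u) (i : Fin N) : ZPeriodic (pd i u) := by
  intro x j
  unfold pd
  have e : (fun y => u (y + Pi.single j 1)) = u := funext fun y => hp y j
  rw [← fderiv_comp_add_right (f := u) (Pi.single j (1:ℝ)), e]

lemma lap_zper {N : ℕ} {u : Pt N → ℝ} (hp : ZPeriodic u) : ZPeriodic (lap u) := by
  intro x j
  unfold lap pd2
  exact Finset.sum_congr rfl fun i _ => fderiv_zper (fderiv_zper hp i) i x j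

lemma lap_cont {N : ℕ} {u : Pt N → ℝ} (hu : ContDiff ℝ 2 u) : Continuous (lap u) := by
  unfold lap pd2
  refine continuous_finsetSum _ fun i _ => ?_
  have := (pd_contDiff hu i).continuous_fderiv (by norm_num)
  exact this.clm_apply continuous_const

lemma Ek_per {N : ℕ} (k : Fin N → ℤ) (x : Pt N) (i : Fin N) : Ek k (x + Pi.single i 1) = Ek k x := by
  rw [← mFourier_eq, ← mFourier_eq]
  congr 1
  ext j
  by_cases h : j = i
  · subst h; simp
  · simp [h]

lemma integrableOn_cube {N : ℕ} {E : Type*} [NormedAddCommGroup E] {f : Pt N → E} (hf : Continuous f) :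
    IntegrableOn f (cube N) := hf.continuousOn.integrableOn_compact isCompact_Icc

lemma lap_coeff {n : ℕ} {u : Pt (n+1) → ℝ} (hu : ContDiff ℝ 2 u) (hp : ZPeriodic u) (k : Fin (n+1) → ℤ) :
    ∫ x in cube (n+1), Ek k x * (lap u x : ℂ) =
      -(4 * π^2 * ∑ i, (k i : ℂ)^2) * ∫ x in cube (n+1), Ek k x * (u x : ℂ) := by
  let f : Fin (n+1) → Pt (n+1) → ℂ := fun i x =>
    ((pd i u x : ℂ) + 2 * π * Complex.I * k i * (u x : ℂ)) * Ek k x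
  have hEd : Differentiable ℝ (Ek k) := (Ek_contDiff k).differentiable (by norm_num)
  have hud : Differentiable ℝ u := hu.differentiable (by norm_num)
  have hpd : ∀ i, Differentiable ℝ (pd i u) := fun i => (pd_contDiff hu i).differentiable (by norm_num)
  have hder : ∀ i x, HasFDerivAt (f i) _ x := fun i x =>
    ((Complex.ofRealCLM.hasFDerivAt.comp x (hpd i x).hasFDerivAt).add
      ((Complex.ofRealCLM.hasFDerivAt.comp x (hud x).hasFDerivAt).const_mul
        (2 * π * Complex.I * k i))).mul (hEd x).hasFDerivAt
  have hval : ∀ i x, fderiv ℝ (f i) x (Pi.single i 1) =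
      Ek k x * (pd2 i i u x : ℂ) + 4 * π^2 * (k i : ℂ)^2 * (Ek k x * (u x : ℂ)) := by
    intro i x
    rw [(hder i x).fderiv]
    simp [Ek_fderiv, pd2]
    simp only [pd]
    linear_combination (-4 * π^2 * (k i : ℂ)^2 * (Ek k x * (u x : ℂ))) * Complex.I_sq
  have hsum : ∀ x, ∑ i, fderiv ℝ (f i) x (Pi.single i 1) =
      Ek k x * (lap u x : ℂ) + (4 * π^2 * ∑ i, (k i : ℂ)^2) * (Ek k x * (u x : ℂ)) := by
    intro x
    simp only [hval, Finset.sum_add_distrib, lap, Complex.ofReal_sum, Finset.mul_sum, Finset.sum_mul]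
  have hEc : Continuous (Ek k) := (Ek_contDiff k).continuous
  have hlc := lap_cont hu
  have huc := hu.continuous
  have hdiv := integral_divergence_of_hasFDerivAt_off_countable' (0 : Pt (n+1)) 1 zero_le_one f
    (fun i x => fderiv ℝ (f i) x) ∅ Set.countable_empty
    (fun i => (continuous_iff_continuousAt.2 fun x => (hder i x).continuousAt).continuousOn)
    (fun x _ i => (hder i x).differentiableAt.hasFDerivAt) (by
      simp only [hsum]
      exact integrableOn_cube (N := n+1) (by fun_prop))
  have hface : ∀ i : Fin (n+1), ∀ y : Fin n → ℝ,
      f i (i.insertNth ((1 : Pt (n+1)) i) y) = f i (i.insertNth ((0 : Pt (n+1)) i) y) := by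
    intro i y
    have e : (i.insertNth ((1 : Pt (n+1)) i) y : Pt (n+1)) =
        (i.insertNth ((0 : Pt (n+1)) i) y : Pt (n+1)) + Pi.single i 1 := by
      ext j
      refine Fin.succAboveCases i ?_ (fun j => ?_) j
      · simp
      · simp
    simp only [f]
    rw [e, fderiv_zper hp i, hp, Ek_per]
  simp only [hface, sub_self, Finset.sum_const_zero, hsum] at hdiv
  rw [integral_add, integral_const_mul] at hdiv
  · change (∫ x in cube (n+1), _) + _ * (∫ x in cube (n+1), _) = _ at hdiv
    rw [neg_mul]
    exact eq_neg_of_add_eq_zero_left hdiv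
  · exact integrableOn_cube (N := n+1) (by fun_prop)
  · exact integrableOn_cube (N := n+1) (by fun_prop)

lemma cauchy3 {N : ℕ} {u : Pt N → ℝ} (hc : Continuous u) (h1 : (∫ x in cube N, (u x)^3) = 1) :
    1 ≤ (∫ x in cube N, (u x)^2) * (∫ x in cube N, (u x)^4) := by
  have key : ∀ t : ℝ, 0 ≤ (∫ x in cube N, (u x)^2) * (t * t) + (-2) * t + (∫ x in cube N, (u x)^4) := by
    intro t
    have h : 0 ≤ ∫ x in cube N, (t * u x - (u x)^2)^2 := integral_nonneg fun x => sq_nonneg _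
    have e : ∀ x, (t * u x - (u x)^2)^2 = (t * t) * (u x)^2 + (-2 * t) * (u x)^3 + (u x)^4 := fun x => by ring
    simp only [e] at h
    rw [integral_add, integral_add, integral_const_mul, integral_const_mul, h1] at h
    · linarith
    all_goals exact integrableOn_cube (by fun_prop)
  have := discrim_le_zero key
  unfold discrim at this
  linarith

lemma cube_eval {n : ℕ} (g : ℝ → ℝ) (hg : Continuous g) :
    ∫ x in cube (n+1), g (x 0) = ∫ t in (0:ℝ)..1, g t := by
  have : IsProbabilityMeasure (volume.restrict (Set.Icc (0:ℝ) 1)) := ⟨by simp⟩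
  have h := measurePreserving_eval (fun _ : Fin (n+1) => volume.restrict (Set.Icc (0:ℝ) 1)) 0
  rw [intervalIntegral.integral_of_le zero_le_one, ← integral_Icc_eq_integral_Ioc, ← h.map_eq,
    integral_map h.measurable.aemeasurable hg.aestronglyMeasurable, ← Measure.restrict_pi_pi,
    Set.pi_univ_Icc]
  rfl

lemma int_cos (n : ℕ) (hn : n ≠ 0) : ∫ t in (0:ℝ)..1, Real.cos (2 * π * n * t) = 0 := by
  have hn' : (2 * π * n : ℝ) ≠ 0 := by positivity
  rw [intervalIntegral.integral_comp_mul_left _ hn', integral_cos]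
  have : Real.sin (2 * π * n * 1) = 0 := by
    have := Real.sin_nat_mul_pi (2 * n)
    rw [← this]; congr 1; push_cast; ring
  rw [this]; simp

lemma exists_adm (n : ℕ) : ∃ u : Pt (n+1) → ℝ, AdmissibleP u := by
  obtain ⟨A, hA⟩ : ∃ A : ℝ, A^3 = 4/3 := ⟨(4/3 : ℝ)^((1:ℝ)/3), by
    rw [← Real.rpow_natCast, ← Real.rpow_mul (by norm_num)]; norm_num⟩
  let C : ℕ → ℝ → ℝ := fun m t => Real.cos (2 * π * m * t)
  have hC : ∀ m, Continuous (C m) := fun m => by fun_prop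
  have hi : ∀ m (a : ℝ), IntervalIntegrable (fun t => a * C m t) volume 0 1 := fun m a =>
    ((hC m).const_mul a).intervalIntegrable _ _ 
  have hI : ∀ m (a : ℝ), m ≠ 0 → ∫ t in (0:ℝ)..1, a * C m t = 0 := fun m a hm => by
    rw [intervalIntegral.integral_const_mul, int_cos m hm, mul_zero]
  refine ⟨fun x => A * C 1 (x 0) + A * C 2 (x 0), ?_, ?_, ?_, ?_⟩
  · simp only [C]; fun_prop
  · intro x i
    have hh : ∀ m : ℕ, C m ((x + Pi.single i 1 : Pt (n+1)) 0) = C m (x 0) := by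
      intro m
      by_cases h : 0 = i
      · subst h
        simp only [C, Pi.add_apply, Pi.single_eq_same]
        rw [← Real.cos_add_nat_mul_two_pi (2 * π * m * x 0) m]
        congr 1; ring
      · simp [h]
    simp only [hh]
  · rw [cube_eval (fun t => (A * C 1 t + A * C 2 t)^3) (by fun_prop)]
    have e : ∀ t, (A * C 1 t + A * C 2 t)^3 = 1 + 3 * C 1 t + 3 * C 2 t + (4/3) * C 3 t + 1 * C 4 t
        + 1 * C 5 t + (1/3) * C 6 t := by
      intro t
      have c2 : C 2 t = 2 * C 1 t ^2 - 1 := by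
        simp only [C]; rw [← Real.cos_two_mul]; congr 1; push_cast; ring
      have c3 : C 3 t = 4 * C 1 t ^3 - 3 * C 1 t := by
        simp only [C]; rw [← Real.cos_three_mul]; congr 1; push_cast; ring
      have c4 : C 4 t = 2 * C 2 t ^2 - 1 := by
        simp only [C]; rw [← Real.cos_two_mul]; congr 1; push_cast; ring
      have c6 : C 6 t = 2 * C 3 t ^2 - 1 := by
        simp only [C]; rw [← Real.cos_two_mul]; congr 1; push_cast; ring
      have c5 : C 5 t = 2 * C 3 t * C 2 t - C 1 t := by
        have := Real.two_mul_cos_mul_cos (2 * π * (3:ℕ) * t) (2 * π * (2:ℕ) * t)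
        simp only [C]
        rw [this]
        have e1 : 2 * π * (3:ℕ) * t - 2 * π * (2:ℕ) * t = 2 * π * (1:ℕ) * t := by push_cast; ring
        have e2 : 2 * π * (3:ℕ) * t + 2 * π * (2:ℕ) * t = 2 * π * (5:ℕ) * t := by push_cast; ring
        rw [e1, e2]; ring
      rw [← mul_add, mul_pow, hA, c5, c6, c4, c3, c2]
      ring
    simp only [e]
    rw [intervalIntegral.integral_add, intervalIntegral.integral_add, intervalIntegral.integral_add,
      intervalIntegral.integral_add, intervalIntegral.integral_add, intervalIntegral.integral_add,
      hI, hI, hI, hI, hI, hI]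
    · simp
    all_goals first | decide | exact Continuous.intervalIntegrable (by fun_prop) _ _
  · rw [cube_eval (fun t => (A * C 1 t + A * C 2 t)) (by fun_prop),
      intervalIntegral.integral_add (hi _ _) (hi _ _), hI _ _ (by decide), hI _ _ (by decide), add_zero]

lemma energy_lower {n : ℕ} (α : ℝ) {u : Pt (n+1) → ℝ} (hu : ContDiff ℝ 2 u) (hp : ZPeriodic u)
    (h0 : (∫ x in cube (n+1), u x) = 0) :
    freqMinPFC (n+1) α * (∫ x in cube (n+1), (u x)^2) ≤ ∫ x in cube (n+1), (α * u x + lap u x)^2 := by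
  have hlc := lap_cont hu
  have huc := hu.continuous
  obtain ⟨F, hF⟩ := exists_lift hp huc
  obtain ⟨G, hG⟩ := exists_lift (f := fun x => α * u x + lap u x)
    (fun x i => by simp only [hp x i, lap_zper hp x i]) (by fun_prop)
  have pF := parseval F
  have pG := parseval G
  simp only [hF, hG, mFourier_eq, Complex.norm_real, norm_eq_abs, sq_abs] at pF pG
  refine hasSum_le (fun k => ?_) (pF.mul_left (freqMinPFC (n+1) α)) pG
  have hEc : Continuous (Ek k) := (Ek_contDiff k).continuous
  have hcoef : ∫ x in cube (n+1), Ek k x * ((α * u x + lap u x : ℝ) : ℂ) =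
      ((α - 4*π^2 * ∑ i, ((k i : ℝ))^2 : ℝ) : ℂ) * ∫ x in cube (n+1), Ek k x * (u x : ℂ) := by
    have e : ∀ x, Ek k x * ((α * u x + lap u x : ℝ) : ℂ) =
        α * (Ek k x * (u x : ℂ)) + Ek k x * (lap u x : ℂ) := fun x => by push_cast; ring
    simp only [e]
    rw [integral_add, integral_const_mul, lap_coeff hu hp]
    · push_cast; ring
    all_goals exact integrableOn_cube (by fun_prop)
  rw [hcoef, norm_mul, mul_pow, Complex.norm_real, norm_eq_abs, sq_abs]
  by_cases hk : k = 0
  · have : ∫ x in cube (n+1), Ek k x * (u x : ℂ) = 0 := by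
      have e : ∀ x, Ek k x * (u x : ℂ) = (u x : ℂ) := fun x => by simp [Ek, hk]
      simp only [e]
      rw [integral_complex_ofReal, h0]; simp
    simp [this]
  · refine mul_le_mul_of_nonneg_right ?_ (by positivity)
    refine csInf_le ⟨0, ?_⟩ ⟨k, hk, rfl⟩
    rintro _ ⟨_, _, rfl⟩
    positivity

/-- Proposition 3.1, part 1. -/
theorem prop_PN_lower_bound (N : ℕ) (hN : 0 < N) (α c : ℝ)
    (hstab : 0 ≤ c + freqMinPFC N α) :
    PN N α c ≥ c + freqMinPFC N α := by
  obtain ⟨n, rfl⟩ : ∃ n, N = n + 1 := ⟨N - 1, by omega⟩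
  obtain ⟨w, hw⟩ := exists_adm n
  refine le_csInf ⟨_, w, hw, rfl⟩ ?_
  rintro _ ⟨u, ⟨hu, hp, h3, h0⟩, rfl⟩
  have hlc := lap_cont hu
  have huc := hu.continuous
  have h1 := cauchy3 huc h3
  have h2 := energy_lower α hu hp h0
  unfold Penergy
  rw [integral_add (integrableOn_cube (by fun_prop)) (integrableOn_cube (by fun_prop)),
    integral_const_mul]
  have h4 : 0 ≤ ∫ x in cube (n+1), (u x)^4 := integral_nonneg fun x => by positivity
  calc c + freqMinPFC (n+1) α ≤ (c + freqMinPFC (n+1) α) *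
        ((∫ x in cube (n+1), (u x)^2) * (∫ x in cube (n+1), (u x)^4)) := le_mul_of_one_le_right hstab h1
    _ = (freqMinPFC (n+1) α * (∫ x in cube (n+1), (u x)^2) + c * (∫ x in cube (n+1), (u x)^2)) *
        (∫ x in cube (n+1), (u x)^4) := by ring
    _ ≤ _ := mul_le_mul_of_nonneg_right (by linarith) h4

end
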